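/- Let K and L be origin-symmetric convex bodies in R^2, each containing the origin in its interior, such that Π_K(t) ≤ Π_L(t) for all t ≥ 0. Then the perimeter of K is at most the perimeter of L (i.e. the 1-dimensional Hausdorff measure of ∂K is at most that of ∂L), and the polar bodies satisfy |K°| ≥ |L°|. -/

import Mathlib

open MeasureTheory Metric Set
open scoped RealInnerProductSpace ENNReal NNReal

noncomputable section

/-- Euclidean space `ℝ^n`. -/
abbrev Euc (n : ℕ) := EuclideanSpace ℝ (Fin n)

/-- A convex body: a compact convex set with nonempty interior. -/
def IsConvexBody {n : ℕ} (K : Set (Euc n)) : Prop :=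
  Convex ℝ K ∧ IsCompact K ∧ (interior K).Nonempty

/-- The Haar (rotation invariant) probability measure of a set of directions on the
unit sphere `S^{n-1}`, realized as normalized `(n-1)`-dimensional Hausdorff measure. -/
def sphHaar (n : ℕ) (A : Set (Euc n)) : ℝ≥0∞ :=
  μH[(n : ℝ) - 1] (A ∩ sphere (0 : Euc n) 1) / μH[(n : ℝ) - 1] (sphere (0 : Euc n) 1)

/-- `|K ∩ θ^⊥|`: the `(n-1)`-dimensional Hausdorff measure of the central section of `K`
perpendicular to `θ`. -/
def sectionVol (n : ℕ) (K : Set (Euc n)) (θ : Euc n) : ℝ≥0∞ :=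
  μH[(n : ℝ) - 1] (K ∩ {x : Euc n | ⟪x, θ⟫ = 0})

/-- `S_K(t)`: distribution function of the areas of central hyperplane sections. -/
def Sdist (n : ℕ) (K : Set (Euc n)) (t : ℝ) : ℝ≥0∞ :=
  sphHaar n {θ : Euc n | ENNReal.ofReal t ≤ sectionVol n K θ}

/-- `|K | θ^⊥|`: the `(n-1)`-dimensional Hausdorff measure of the orthogonal projection
of `K` onto the hyperplane `θ^⊥` (for a unit vector `θ`). -/
def projVol (n : ℕ) (K : Set (Euc n)) (θ : Euc n) : ℝ≥0∞ :=
  μH[(n : ℝ) - 1] ((fun x => x - ⟪x, θ⟫ • θ) '' K)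

/-- `Π_K(t)`: distribution function of the volumes of hyperplane projections. -/
def PiDist (n : ℕ) (K : Set (Euc n)) (t : ℝ) : ℝ≥0∞ :=
  sphHaar n {θ : Euc n | ENNReal.ofReal t ≤ projVol n K θ}

/-- The radial function `ρ_K(θ) = max {a ≥ 0 : a • θ ∈ K}`. -/
def radial {n : ℕ} (K : Set (Euc n)) (θ : Euc n) : ℝ :=
  sSup {a : ℝ | 0 ≤ a ∧ a • θ ∈ K}

/-- The support function `h_K(θ) = sup_{y ∈ K} ⟨θ, y⟩`. -/
def suppFn {n : ℕ} (K : Set (Euc n)) (θ : Euc n) : ℝ :=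
  sSup ((fun y => ⟪θ, y⟫) '' K)

/-- The polar body `K° = {x : ⟨x, y⟩ ≤ 1 for all y ∈ K}`. -/
def polarBody {n : ℕ} (K : Set (Euc n)) : Set (Euc n) :=
  {x | ∀ y ∈ K, ⟪x, y⟫ ≤ 1}


/-! ### Complex multiplication on the Euclidean plane -/

/-- Multiplication of complex numbers, written on the Euclidean plane. -/
def planeMul (x y : Euc 2) : Euc 2 := !₂[x 0 * y 0 - x 1 * y 1, x 0 * y 1 + x 1 * y 0]

lemma planeMul_comm (x y : Euc 2) : planeMul x y = planeMul y x := by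
  ext i; fin_cases i <;> simp [planeMul] <;> ring

lemma planeMul_smul (x : Euc 2) (r : ℝ) (y : Euc 2) :
    planeMul x (r • y) = r • planeMul x y := by
  ext i; fin_cases i <;> simp [planeMul] <;> ring

lemma norm_sq_eq_plane (x : Euc 2) : ‖x‖ ^ 2 = x 0 ^ 2 + x 1 ^ 2 := by
  simp [EuclideanSpace.norm_sq_eq, Fin.sum_univ_two]

lemma inner_eq_plane (x y : Euc 2) : ⟪x, y⟫ = x 0 * y 0 + x 1 * y 1 := by
  simp [PiLp.inner_apply, Fin.sum_univ_two, mul_comm]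

lemma norm_planeMul (x y : Euc 2) : ‖planeMul x y‖ = ‖x‖ * ‖y‖ := by
  rw [← sq_eq_sq₀ (norm_nonneg _) (by positivity), mul_pow, norm_sq_eq_plane, norm_sq_eq_plane,
    norm_sq_eq_plane]
  simp [planeMul]
  ring

lemma continuous_planeMul : Continuous fun p : Euc 2 × Euc 2 => planeMul p.1 p.2 := by
  unfold planeMul
  refine (PiLp.continuous_toLp 2 _).comp (continuous_pi fun i => ?_)
  fin_cases i <;> simp <;> fun_prop

/-- Multiplication by a unit vector as a linear isometry. -/
def rotationEquiv (x : Euc 2) (hx : ‖x‖ = 1) : Euc 2 ≃ₗᵢ[ℝ] Euc 2 :=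
  LinearIsometry.toLinearIsometryEquiv
    { toFun := planeMul x
      map_add' := fun y z => by ext i; fin_cases i <;> simp [planeMul] <;> ring
      map_smul' := fun r y => planeMul_smul x r y
      norm_map' := fun y => by
        change ‖planeMul x y‖ = ‖y‖
        rw [norm_planeMul, hx, one_mul] }
    rfl

@[simp] lemma rotationEquiv_apply (x : Euc 2) (hx : ‖x‖ = 1) (y : Euc 2) :
    rotationEquiv x hx y = planeMul x y := rfl

lemma inner_planeMul_planeMul {x : Euc 2} (hx : ‖x‖ = 1) (y z : Euc 2) :
    ⟪planeMul x y, planeMul x z⟫ = ⟪y, z⟫ :=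
  (rotationEquiv x hx).inner_map_map y z

/-! ### The arc length measure on the circle -/

/-- One-dimensional Hausdorff measure on the unit circle. -/
def circleMeasure : Measure (Euc 2) := (μH[1] : Measure (Euc 2)).restrict (sphere 0 1)

/-- The point of the unit circle with the given angle. -/
def circlePoint (t : ℝ) : Euc 2 := !₂[Real.cos t, Real.sin t]

@[simp] lemma circlePoint_zero_coord (t : ℝ) : circlePoint t 0 = Real.cos t := rfl

@[simp] lemma circlePoint_one_coord (t : ℝ) : circlePoint t 1 = Real.sin t := rfl

@[simp] lemma norm_circlePoint (t : ℝ) : ‖circlePoint t‖ = 1 := by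
  rw [← sq_eq_sq₀ (norm_nonneg _) zero_le_one, norm_sq_eq_plane]
  simp

lemma continuous_circlePoint : Continuous circlePoint := by
  refine (PiLp.continuous_toLp 2 _).comp (continuous_pi fun i => ?_)
  fin_cases i <;> simp <;> fun_prop

lemma circlePoint_sub_pi (t : ℝ) : circlePoint (t - Real.pi) = -circlePoint t := by
  ext i; fin_cases i <;> simp [circlePoint, Real.cos_sub_pi, Real.sin_sub_pi]

lemma exists_eq_norm_smul_circlePoint {x : Euc 2} (hx : 0 ≤ x 1) :
    ∃ t ∈ Icc 0 Real.pi, x = ‖x‖ • circlePoint t := by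
  rcases eq_or_ne x 0 with rfl | h0
  · exact ⟨0, ⟨le_rfl, Real.pi_pos.le⟩, by simp⟩
  have hn : 0 < ‖x‖ := norm_pos_iff.2 h0
  have hsq := norm_sq_eq_plane x
  have hle : |x 0| ≤ ‖x‖ := abs_le_of_sq_le_sq (by nlinarith [sq_nonneg (x 1)]) hn.le
  have h1 : -1 ≤ x 0 / ‖x‖ := by rw [le_div_iff₀ hn]; linarith [(abs_le.1 hle).1]
  have h2 : x 0 / ‖x‖ ≤ 1 := by rw [div_le_iff₀ hn]; linarith [(abs_le.1 hle).2]
  refine ⟨Real.arccos (x 0 / ‖x‖), ⟨Real.arccos_nonneg _, Real.arccos_le_pi _⟩, ?_⟩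
  have hs : √(1 - (x 0 / ‖x‖) ^ 2) = x 1 / ‖x‖ := by
    rw [show 1 - (x 0 / ‖x‖) ^ 2 = (x 1 / ‖x‖) ^ 2 by field_simp; linarith]
    exact Real.sqrt_sq (by positivity)
  ext i; fin_cases i
  · simp [circlePoint, Real.cos_arccos h1 h2, mul_div_cancel₀ _ hn.ne']
  · simp [circlePoint, Real.sin_arccos, hs, mul_div_cancel₀ _ hn.ne']

lemma exists_eq_smul_circlePoint (x : Euc 2) :
    ∃ t ∈ Icc 0 Real.pi, x = ‖x‖ • circlePoint t ∨ x = -(‖x‖ • circlePoint t) := by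
  rcases le_total 0 (x 1) with h | h
  · obtain ⟨t, ht, hx⟩ := exists_eq_norm_smul_circlePoint h
    exact ⟨t, ht, .inl hx⟩
  · obtain ⟨t, ht, hx⟩ := exists_eq_norm_smul_circlePoint (x := -x) (by simpa using h)
    exact ⟨t, ht, .inr (by rw [norm_neg] at hx; rw [← hx, neg_neg])⟩

lemma exists_unit_smul (x : Euc 2) : ∃ w : Euc 2, ‖w‖ = 1 ∧ x = ‖x‖ • w := by
  obtain ⟨t, -, h | h⟩ := exists_eq_smul_circlePoint x
  · exact ⟨_, norm_circlePoint t, h⟩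
  · exact ⟨-circlePoint t, by simp, by rw [smul_neg]; exact h⟩

lemma hausdorffMeasure_Icc (a b : ℝ) : μH[1] (Icc a b) = ENNReal.ofReal (b - a) := by
  rw [MeasureTheory.hausdorffMeasure_real, Real.volume_Icc]

lemma lipschitzWith_circlePoint : LipschitzWith 2 circlePoint := by
  refine LipschitzWith.of_dist_le_mul fun s t => ?_
  have hc := Real.lipschitzWith_cos.dist_le_mul s t
  have hs := Real.lipschitzWith_sin.dist_le_mul s t
  have h := norm_sq_eq_plane (circlePoint s - circlePoint t)
  simp only [Real.dist_eq, NNReal.coe_one, one_mul, dist_eq_norm (circlePoint s)] at *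
  refine abs_le_of_sq_le_sq' ?_ (by positivity) |>.2
  rw [h]
  simp only [PiLp.sub_apply, circlePoint_zero_coord, circlePoint_one_coord]
  have h1 := pow_le_pow_left₀ (abs_nonneg _) hc 2
  have h2 := pow_le_pow_left₀ (abs_nonneg _) hs 2
  rw [sq_abs] at h1 h2
  rw [mul_pow]
  norm_num
  nlinarith [sq_nonneg (s - t), sq_abs (s - t)]

instance isFiniteMeasure_circleMeasure : IsFiniteMeasure circleMeasure := by
  refine ⟨?_⟩
  rw [circleMeasure, Measure.restrict_apply_univ]
  have hsub : sphere (0 : Euc 2) 1 ⊆ circlePoint '' Icc 0 Real.pi ∪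
      (LinearIsometryEquiv.neg ℝ (E := Euc 2)) '' (circlePoint '' Icc 0 Real.pi) := by
    intro x hx
    obtain ⟨t, ht, h⟩ := exists_eq_smul_circlePoint x
    rw [mem_sphere_zero_iff_norm.1 hx, one_smul] at h
    rcases h with h | h
    · exact .inl ⟨t, ht, h.symm⟩
    · exact .inr ⟨_, ⟨t, ht, rfl⟩, by simp [← h]⟩
  have hfin : μH[1] (circlePoint '' Icc 0 Real.pi) < ∞ := by
    refine (lipschitzWith_circlePoint.lipschitzOnWith.hausdorffMeasure_image_le
      zero_le_one).trans_lt ?_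
    rw [hausdorffMeasure_Icc]
    exact ENNReal.mul_lt_top (by simp) ENNReal.ofReal_lt_top
  refine (measure_mono hsub).trans_lt ((measure_union_le _ _).trans_lt ?_)
  rw [(LinearIsometryEquiv.neg ℝ (E := Euc 2)).isometry.hausdorffMeasure_image (.inl zero_le_one)]
  exact ENNReal.add_lt_top.2 ⟨hfin, hfin⟩

lemma circleMeasure_univ_ne_zero : circleMeasure univ ≠ 0 := by
  rw [circleMeasure, Measure.restrict_apply_univ]
  have hlip : LipschitzWith 1 (fun x : Euc 2 => x 0) := by
    refine LipschitzWith.of_dist_le_mul fun x y => ?_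
    have h := norm_sq_eq_plane (x - y)
    rw [Real.dist_eq, dist_eq_norm, NNReal.coe_one, one_mul]
    refine abs_le_of_sq_le_sq ?_ (norm_nonneg _)
    rw [h]
    simp only [PiLp.sub_apply]
    nlinarith [sq_nonneg (x 1 - y 1)]
  have h := hlip.lipschitzOnWith.hausdorffMeasure_image_le (s := sphere (0 : Euc 2) 1) zero_le_one
  have hsub : Icc (-1 : ℝ) 1 ⊆ (fun x : Euc 2 => x 0) '' sphere 0 1 := fun y hy =>
    ⟨circlePoint (Real.arccos y), by simp, by simp [Real.cos_arccos hy.1 hy.2]⟩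
  have h2 := (measure_mono hsub).trans h
  rw [hausdorffMeasure_Icc] at h2
  intro h0
  rw [h0] at h2
  norm_num at h2

lemma measurePreserving_planeMul_circleMeasure {x : Euc 2} (hx : ‖x‖ = 1) :
    MeasurePreserving (planeMul x) circleMeasure circleMeasure := by
  have h := ((rotationEquiv x hx).toIsometryEquiv.measurePreserving_hausdorffMeasure 1
    ).restrict_preimage (s := sphere (0 : Euc 2) 1) isClosed_sphere.measurableSet
  have hpre : (rotationEquiv x hx).toIsometryEquiv ⁻¹' sphere (0 : Euc 2) 1 = sphere 0 1 := by
    ext y; simp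
  rw [hpre] at h
  exact h

lemma ae_circleMeasure_norm : ∀ᵐ θ ∂circleMeasure, ‖θ‖ = 1 := by
  have := ae_restrict_mem (μ := (μH[1] : Measure (Euc 2))) (s := sphere (0 : Euc 2) 1)
    isClosed_sphere.measurableSet
  filter_upwards [this] with θ hθ using by simpa using hθ

/-! ### The projection integral of a vector -/

/-- The integral over the circle of the length of the projections of a unit vector. -/
def cauchyConstant : ℝ≥0∞ := ∫⁻ θ, ‖⟪circlePoint 0, θ⟫‖ₑ ∂circleMeasure

lemma measurable_enorm_inner (v : Euc 2) : Measurable fun θ : Euc 2 => ‖⟪v, θ⟫‖ₑ := by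
  fun_prop

lemma planeMul_circlePoint_zero (x : Euc 2) : planeMul x (circlePoint 0) = x := by
  ext i; fin_cases i <;> simp [planeMul]

lemma lintegral_enorm_inner (v : Euc 2) :
    ∫⁻ θ, ‖⟪v, θ⟫‖ₑ ∂circleMeasure = cauchyConstant * ‖v‖ₑ := by
  obtain ⟨w, hw, hv⟩ := exists_unit_smul v
  have hmp := measurePreserving_planeMul_circleMeasure hw
  have h1 : ∫⁻ θ, ‖⟪w, θ⟫‖ₑ ∂circleMeasure = cauchyConstant := by
    rw [← hmp.lintegral_comp (measurable_enorm_inner w), cauchyConstant]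
    refine lintegral_congr fun θ => ?_
    rw [← inner_planeMul_planeMul hw (circlePoint 0) θ, planeMul_circlePoint_zero]
  have h2 : ∀ θ, ‖⟪v, θ⟫‖ₑ = ‖v‖ₑ * ‖⟪w, θ⟫‖ₑ := fun θ => by
    conv_lhs => rw [hv]
    rw [real_inner_smul_left, enorm_mul, enorm_norm]
  simp_rw [h2]
  rw [lintegral_const_mul _ (measurable_enorm_inner w), h1, mul_comm]

lemma cauchyConstant_ne_zero : cauchyConstant ≠ 0 := by
  intro h
  have key : ∀ v : Euc 2, ∀ᵐ θ ∂circleMeasure, ⟪v, θ⟫ = 0 := fun v => by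
    have h0 := lintegral_enorm_inner v
    rw [h, zero_mul, lintegral_eq_zero_iff (measurable_enorm_inner v)] at h0
    filter_upwards [h0] with θ hθ using by simpa using hθ
  have hF : ∀ᵐ θ ∂circleMeasure, False := by
    filter_upwards [key !₂[1, 0], key !₂[0, 1], ae_circleMeasure_norm] with θ h1 h2 h3
    have h4 := norm_sq_eq_plane θ
    simp [inner_eq_plane] at h1 h2
    rw [h1, h2, h3] at h4
    norm_num at h4
  rw [ae_iff] at hF
  exact circleMeasure_univ_ne_zero (by simpa using hF)

lemma cauchyConstant_ne_top : cauchyConstant ≠ ∞ := by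
  have h : cauchyConstant ≤ ∫⁻ _, 1 ∂circleMeasure := by
    refine lintegral_mono_ae ?_
    filter_upwards [ae_circleMeasure_norm] with θ hθ
    rw [Real.enorm_eq_ofReal_abs, ENNReal.ofReal_le_one]
    simpa [hθ] using abs_real_inner_le_norm (circlePoint 0) θ
  refine ne_top_of_le_ne_top ?_ h
  simp

/-! ### Support functions of symmetric bodies -/

/-- A compact convex symmetric neighbourhood of the origin in the plane. -/
structure IsCenteredBody (K : Set (Euc 2)) : Prop where
  convex : Convex ℝ K
  isCompact : IsCompact K
  neg_mem : ∀ x ∈ K, -x ∈ K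
  mem_nhds : K ∈ nhds 0

namespace IsCenteredBody

variable {K : Set (Euc 2)}

lemma zero_mem (hK : IsCenteredBody K) : (0 : Euc 2) ∈ K := mem_of_mem_nhds hK.mem_nhds

lemma bddAbove_inner (hK : IsCenteredBody K) (θ : Euc 2) :
    BddAbove ((fun y => ⟪θ, y⟫) '' K) :=
  hK.isCompact.bddAbove_image (by fun_prop)

lemma inner_le_suppFn (hK : IsCenteredBody K) (θ : Euc 2) {y : Euc 2} (hy : y ∈ K) :
    ⟪θ, y⟫ ≤ suppFn K θ :=
  le_csSup (hK.bddAbove_inner θ) (mem_image_of_mem _ hy)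

lemma abs_inner_le_suppFn (hK : IsCenteredBody K) (θ : Euc 2) {y : Euc 2} (hy : y ∈ K) :
    |⟪θ, y⟫| ≤ suppFn K θ := by
  refine abs_le'.2 ⟨hK.inner_le_suppFn θ hy, ?_⟩
  simpa using hK.inner_le_suppFn θ (hK.neg_mem y hy)

lemma exists_inner_eq_suppFn (hK : IsCenteredBody K) (θ : Euc 2) :
    ∃ y ∈ K, ⟪θ, y⟫ = suppFn K θ :=
  (hK.isCompact.exists_sSup_image_eq ⟨0, hK.zero_mem⟩ (by fun_prop)).imp
    fun _ h => ⟨h.1, h.2.symm⟩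

lemma suppFn_le (hK : IsCenteredBody K) {θ : Euc 2} {r : ℝ} (h : ∀ y ∈ K, ⟪θ, y⟫ ≤ r) :
    suppFn K θ ≤ r := by
  obtain ⟨y, hy, he⟩ := hK.exists_inner_eq_suppFn θ
  exact he ▸ h y hy

lemma suppFn_nonneg (hK : IsCenteredBody K) (θ : Euc 2) : 0 ≤ suppFn K θ := by
  simpa using hK.inner_le_suppFn θ hK.zero_mem

lemma suppFn_smul (hK : IsCenteredBody K) {r : ℝ} (hr : 0 ≤ r) (θ : Euc 2) :
    suppFn K (r • θ) = r * suppFn K θ := by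
  apply le_antisymm
  · refine hK.suppFn_le fun y hy => ?_
    rw [real_inner_smul_left]
    exact mul_le_mul_of_nonneg_left (hK.inner_le_suppFn θ hy) hr
  · obtain ⟨y, hy, he⟩ := hK.exists_inner_eq_suppFn θ
    rw [← he, ← real_inner_smul_left]
    exact hK.inner_le_suppFn _ hy

lemma continuous_suppFn (hK : IsCenteredBody K) : Continuous (suppFn K) := by
  obtain ⟨R, hR⟩ := hK.isCompact.isBounded.exists_norm_le
  have hR0 : 0 ≤ R := (norm_nonneg _).trans (hR 0 hK.zero_mem)
  refine (LipschitzWith.of_le_add_mul R.toNNReal fun θ η => hK.suppFn_le fun y hy => ?_).continuous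
  have h1 : ⟪θ, y⟫ = ⟪η, y⟫ + ⟪θ - η, y⟫ := by rw [inner_sub_left]; ring
  have h2 := (real_inner_le_norm (θ - η) y).trans
    (mul_le_mul_of_nonneg_left (hR y hy) (norm_nonneg _))
  rw [h1, dist_eq_norm, Real.coe_toNNReal R hR0, mul_comm R]
  exact add_le_add (hK.inner_le_suppFn η hy) h2

lemma image_inner_eq_Icc (hK : IsCenteredBody K) (θ : Euc 2) :
    (fun y => ⟪θ, y⟫) '' K = Icc (-suppFn K θ) (suppFn K θ) := by
  apply Subset.antisymm
  · rintro _ ⟨y, hy, rfl⟩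
    exact abs_le.1 (hK.abs_inner_le_suppFn θ hy)
  · obtain ⟨y, hy, he⟩ := hK.exists_inner_eq_suppFn θ
    have := hK.convex.isPreconnected.intermediate_value (hK.neg_mem y hy) hy
      (f := fun y => ⟪θ, y⟫) (by fun_prop)
    simpa [he] using this

/-- The support function in a perpendicular direction gives half the length of a projection. -/
lemma projVol_eq (hK : IsCenteredBody K) {θ : Euc 2} (hθ : ‖θ‖ = 1) :
    projVol 2 K θ = ENNReal.ofReal (2 * suppFn K (planeMul !₂[0, 1] θ)) := by
  set η := planeMul !₂[0, 1] θ with hη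
  have hηn : ‖η‖ = 1 := by
    rw [hη, norm_planeMul, hθ, mul_one, ← sq_eq_sq₀ (norm_nonneg _) zero_le_one, norm_sq_eq_plane]
    simp
  have hsq := norm_sq_eq_plane θ
  rw [hθ] at hsq
  have himg : (fun x => x - ⟪x, θ⟫ • θ) '' K =
      (fun s : ℝ => s • η) '' ((fun y => ⟪η, y⟫) '' K) := by
    rw [image_image]
    refine image_congr fun x _ => ?_
    ext i; fin_cases i <;> simp [hη, inner_eq_plane, planeMul]
    · linear_combination x 0 * hsq
    · linear_combination x 1 * hsq
  have hiso : Isometry fun s : ℝ => s • η := Isometry.of_dist_eq fun s t => by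
    rw [dist_eq_norm, ← sub_smul, norm_smul, hηn, mul_one, dist_eq_norm]
  have h1 : ((2 : ℕ) : ℝ) - 1 = 1 := by norm_num
  rw [projVol, himg, h1, hiso.hausdorffMeasure_image (.inl zero_le_one), hK.image_inner_eq_Icc,
    hausdorffMeasure_Icc]
  congr 1
  ring

lemma PiDist_two_mul (hK : IsCenteredBody K) (s : ℝ) :
    PiDist 2 K (2 * s) = circleMeasure {θ | s ≤ suppFn K θ} / circleMeasure univ := by
  have hi : ‖(!₂[0, 1] : Euc 2)‖ = 1 := by
    rw [← sq_eq_sq₀ (norm_nonneg _) zero_le_one, norm_sq_eq_plane]; simp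
  have hmeas : MeasurableSet {θ : Euc 2 | s ≤ suppFn K θ} :=
    measurableSet_le measurable_const hK.continuous_suppFn.measurable
  have h1 : ((2 : ℕ) : ℝ) - 1 = 1 := by norm_num
  rw [PiDist, sphHaar, h1, ← (measurePreserving_planeMul_circleMeasure hi).measure_preimage
    hmeas.nullMeasurableSet, circleMeasure, Measure.restrict_apply_univ,
    Measure.restrict_apply' isClosed_sphere.measurableSet]
  congr 2
  ext θ
  simp only [mem_inter_iff, mem_ofPred_eq, mem_sphere_zero_iff_norm, mem_preimage]
  refine and_congr_left fun hθ => ?_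
  rw [hK.projVol_eq hθ, ENNReal.ofReal_le_ofReal_iff
    (mul_nonneg zero_le_two (hK.suppFn_nonneg _))]
  constructor <;> intro h <;> linarith

/-! ### Volume of the polar body -/

lemma polarBody_eq (hK : IsCenteredBody K) : polarBody K = {x | suppFn K x ≤ 1} := by
  ext x
  exact ⟨fun h => hK.suppFn_le h, fun h y hy => (hK.inner_le_suppFn x hy).trans h⟩

lemma circleMeasure_mul_volume_polarBody (hK : IsCenteredBody K) :
    circleMeasure univ * volume (polarBody K) =
      ∫⁻ x : Euc 2, circleMeasure {θ | ‖x‖ * suppFn K θ ≤ 1} := by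
  have hset : MeasurableSet {p : Euc 2 × Euc 2 | suppFn K (planeMul p.1 p.2) ≤ 1} :=
    measurableSet_le (hK.continuous_suppFn.comp continuous_planeMul).measurable measurable_const
  have hpolar : MeasurableSet (polarBody K) := by
    rw [hK.polarBody_eq]
    exact measurableSet_le hK.continuous_suppFn.measurable measurable_const
  have h1 := Measure.prod_apply (μ := circleMeasure) (ν := (volume : Measure (Euc 2))) hset
  rw [Measure.prod_apply_symm hset] at h1
  have h2 : ∫⁻ θ, volume (Prod.mk θ ⁻¹' {p : Euc 2 × Euc 2 | suppFn K (planeMul p.1 p.2) ≤ 1})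
      ∂circleMeasure = ∫⁻ _, volume (polarBody K) ∂circleMeasure := by
    refine lintegral_congr_ae ?_
    filter_upwards [ae_circleMeasure_norm] with θ hθ
    rw [← (rotationEquiv θ hθ).measurePreserving.measure_preimage hpolar.nullMeasurableSet,
      hK.polarBody_eq]
    rfl
  rw [h2, lintegral_const, mul_comm] at h1
  rw [← h1]
  refine lintegral_congr fun x => ?_
  obtain ⟨w, hw, hx⟩ := exists_unit_smul x
  have hmeas : MeasurableSet {θ : Euc 2 | ‖x‖ * suppFn K θ ≤ 1} :=
    measurableSet_le (hK.continuous_suppFn.measurable.const_mul _) measurable_const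
  rw [← (measurePreserving_planeMul_circleMeasure hw).measure_preimage hmeas.nullMeasurableSet]
  congr 1
  ext θ
  simp only [mem_preimage, mem_ofPred_eq]
  conv_lhs => rw [hx, planeMul_smul, planeMul_comm, hK.suppFn_smul (norm_nonneg x)]

end IsCenteredBody

lemma circleMeasure_suppFn_lt_le {K L : Set (Euc 2)}
    (h : ∀ s, 0 ≤ s → circleMeasure {θ | s ≤ suppFn K θ} ≤ circleMeasure {θ | s ≤ suppFn L θ})
    {s : ℝ} (hs : 0 ≤ s) :
    circleMeasure {θ | s < suppFn K θ} ≤ circleMeasure {θ | s < suppFn L θ} := by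
  have hU : {θ | s < suppFn K θ} = ⋃ n : ℕ, {θ | s + 1 / ((n : ℝ) + 1) ≤ suppFn K θ} := by
    ext θ
    simp only [mem_ofPred_eq, mem_iUnion]
    constructor
    · intro hlt
      obtain ⟨n, hn⟩ := exists_nat_one_div_lt (sub_pos.2 hlt)
      exact ⟨n, by linarith⟩
    · rintro ⟨n, hn⟩
      have : (0 : ℝ) < 1 / ((n : ℝ) + 1) := by positivity
      linarith
  have hmono : Monotone fun n : ℕ => {θ | s + 1 / ((n : ℝ) + 1) ≤ suppFn K θ} := by
    intro m n hmn θ hθ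
    simp only [mem_ofPred_eq] at hθ ⊢
    have : 1 / ((n : ℝ) + 1) ≤ 1 / ((m : ℝ) + 1) := by gcongr
    linarith
  rw [hU, hmono.measure_iUnion]
  refine iSup_le fun n => ?_
  have hpos : (0 : ℝ) < 1 / ((n : ℝ) + 1) := by positivity
  refine (h _ (by linarith)).trans (measure_mono fun θ hθ => ?_)
  simp only [mem_ofPred_eq] at hθ ⊢
  linarith

lemma volume_polarBody_le {K L : Set (Euc 2)} (hK : IsCenteredBody K) (hL : IsCenteredBody L)
    (h : ∀ s, 0 ≤ s → circleMeasure {θ | s ≤ suppFn K θ} ≤ circleMeasure {θ | s ≤ suppFn L θ}) :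
    volume (polarBody L) ≤ volume (polarBody K) := by
  rw [← ENNReal.mul_le_mul_iff_right circleMeasure_univ_ne_zero (measure_ne_top _ _),
    hK.circleMeasure_mul_volume_polarBody, hL.circleMeasure_mul_volume_polarBody]
  refine lintegral_mono fun x => ?_
  rcases eq_or_ne x 0 with rfl | hx
  · simp
  have hn : 0 < ‖x‖ := norm_pos_iff.2 hx
  have hcompl : ∀ M : Set (Euc 2),
      {θ | ‖x‖ * suppFn M θ ≤ 1} = {θ | ‖x‖⁻¹ < suppFn M θ}ᶜ := fun M => by
    ext θ
    simp only [mem_ofPred_eq, mem_compl_iff, not_lt]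
    rw [← le_div_iff₀' hn, one_div]
  have hmeas : ∀ M, IsCenteredBody M → MeasurableSet {θ : Euc 2 | ‖x‖⁻¹ < suppFn M θ} :=
    fun M hM => measurableSet_lt measurable_const hM.continuous_suppFn.measurable
  rw [hcompl, hcompl, measure_compl (hmeas L hL) (measure_ne_top _ _),
    measure_compl (hmeas K hK) (measure_ne_top _ _)]
  exact tsub_le_tsub_left (circleMeasure_suppFn_lt_le h (inv_nonneg.2 hn.le)) _

lemma lintegral_suppFn_le {K L : Set (Euc 2)} (hK : IsCenteredBody K) (hL : IsCenteredBody L)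
    (h : ∀ s, 0 ≤ s → circleMeasure {θ | s ≤ suppFn K θ} ≤ circleMeasure {θ | s ≤ suppFn L θ}) :
    ∫⁻ θ, ENNReal.ofReal (suppFn K θ) ∂circleMeasure ≤
      ∫⁻ θ, ENNReal.ofReal (suppFn L θ) ∂circleMeasure := by
  have key : ∀ M, IsCenteredBody M → ∫⁻ θ, ENNReal.ofReal (suppFn M θ) ∂circleMeasure =
      ∫⁻ t in Ioi 0, circleMeasure {θ | t ≤ suppFn M θ} := fun M hM =>
    lintegral_eq_lintegral_meas_le _ (.of_forall hM.suppFn_nonneg)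
      hM.continuous_suppFn.aemeasurable
  rw [key K hK, key L hL]
  exact setLIntegral_mono' measurableSet_Ioi fun t ht => h t (le_of_lt ht)

/-! ### Hausdorff measure and variation of curves -/

lemma hausdorffMeasure_image_Icc_le_eVariationOn (γ : ℝ → Euc 2) {a b : ℝ} (hab : a ≤ b) :
    μH[1] (γ '' Icc a b) ≤ eVariationOn γ (Icc a b) := by
  by_cases htop : eVariationOn γ (Icc a b) = ∞
  · simp [htop]
  have hloc : LocallyBoundedVariationOn γ (Icc a b) :=
    BoundedVariationOn.locallyBoundedVariationOn htop
  have ha : a ∈ Icc a b := left_mem_Icc.2 hab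
  set V := variationOnFromTo γ (Icc a b) a
  set p := naturalParameterization γ (Icc a b) a
  have hspeed : HasUnitSpeedOn p (V '' Icc a b) := has_unit_speed_naturalParameterization γ hloc ha
  have hordered : ∀ x ∈ V '' Icc a b, ∀ y ∈ V '' Icc a b, x ≤ y →
      edist (p x) (p y) ≤ edist x y := by
    intro x hx y hy hxy
    have h := eVariationOn.edist_le p (s := V '' Icc a b ∩ Icc x y)
      ⟨hx, left_mem_Icc.2 hxy⟩ ⟨hy, right_mem_Icc.2 hxy⟩
    rwa [hspeed hx hy, NNReal.coe_one, one_mul, ← abs_of_nonneg (sub_nonneg.2 hxy),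
      ← Real.dist_eq, ← edist_dist, edist_comm y x] at h
  have hlip : LipschitzOnWith 1 p (V '' Icc a b) := by
    intro x hx y hy
    rw [ENNReal.coe_one, one_mul]
    rcases le_total x y with hxy | hxy
    · exact hordered x hx y hy hxy
    · rw [edist_comm, edist_comm x]
      exact hordered y hy x hx hxy
  have hsub : γ '' Icc a b ⊆ p '' (V '' Icc a b) := by
    rintro _ ⟨t, ht, rfl⟩
    exact ⟨V t, mem_image_of_mem _ ht,
      edist_eq_zero.1 (edist_naturalParameterization_eq_zero hloc ha ht)⟩
  have hV : V '' Icc a b ⊆ Icc 0 (eVariationOn γ (Icc a b)).toReal := by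
    rintro _ ⟨t, ht, rfl⟩
    refine ⟨variationOnFromTo.nonneg_of_le _ _ ht.1, ?_⟩
    simp only [V]
    rw [variationOnFromTo.eq_of_le _ _ ht.1]
    exact ENNReal.toReal_mono htop (eVariationOn.mono _ inter_subset_left)
  calc μH[1] (γ '' Icc a b) ≤ μH[1] (p '' (V '' Icc a b)) := measure_mono hsub
    _ ≤ μH[1] (V '' Icc a b) := by
      simpa using hlip.hausdorffMeasure_image_le zero_le_one
    _ ≤ μH[1] (Icc 0 (eVariationOn γ (Icc a b)).toReal) := measure_mono hV
    _ = eVariationOn γ (Icc a b) := by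
      rw [hausdorffMeasure_Icc, sub_zero, ENNReal.ofReal_toReal htop]

lemma edist_le_hausdorffMeasure_image_Ico {γ : ℝ → Euc 2} (hγ : Continuous γ) {a b : ℝ}
    (hab : a ≤ b) : edist (γ a) (γ b) ≤ μH[1] (γ '' Ico a b) := by
  have hlip : LipschitzWith 1 (dist (γ a)) := LipschitzWith.dist_right _
  have h := hlip.lipschitzOnWith.hausdorffMeasure_image_le (s := γ '' Ico a b) zero_le_one
  have hsub := intermediate_value_Ico hab (f := fun t => dist (γ a) (γ t)) (by fun_prop)
  rw [dist_self, ← image_image (dist (γ a)) γ] at hsub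
  have h2 := (measure_mono hsub).trans h
  rw [MeasureTheory.hausdorffMeasure_real, Real.volume_Ico, sub_zero, ← edist_dist] at h2
  simpa using h2

lemma sum_edist_le_hausdorffMeasure_image_Ico {γ : ℝ → Euc 2} (hγ : Continuous γ) {t : ℕ → ℝ}
    (ht : Monotone t) (n : ℕ) (hinj : InjOn γ (Ico (t 0) (t n))) :
    ∑ i ∈ Finset.range n, edist (γ (t i)) (γ (t (i + 1))) ≤ μH[1] (γ '' Ico (t 0) (t n)) := by
  induction n with
  | zero => simp
  | succ n ih =>
    have h1 : Ico (t 0) (t (n + 1)) = Ico (t 0) (t n) ∪ Ico (t n) (t (n + 1)) :=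
      (Ico_union_Ico_eq_Ico (ht n.zero_le) (ht n.le_succ)).symm
    have hs1 : Ico (t 0) (t n) ⊆ Ico (t 0) (t (n + 1)) := h1 ▸ subset_union_left
    have hs2 : Ico (t n) (t (n + 1)) ⊆ Ico (t 0) (t (n + 1)) := h1 ▸ subset_union_right
    have hdisj : Disjoint (γ '' Ico (t 0) (t n)) (γ '' Ico (t n) (t (n + 1))) :=
      disjoint_left.2 <| by
        rintro _ ⟨x, hx, rfl⟩ ⟨y, hy, he⟩
        have := hinj (hs2 hy) (hs1 hx) he
        linarith [hx.2, hy.1]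
    rw [Finset.sum_range_succ, h1, image_union, measure_union hdisj
      (measurableSet_Ico.image_of_continuousOn_injOn hγ.continuousOn (hinj.mono hs2))]
    exact add_le_add (ih (hinj.mono hs1)) (edist_le_hausdorffMeasure_image_Ico hγ (ht n.le_succ))

/-! ### The boundary curve -/

/-- The boundary point of `K` in the direction of the given angle. -/
def boundaryCurve (K : Set (Euc 2)) (t : ℝ) : Euc 2 :=
  (gauge K (circlePoint t))⁻¹ • circlePoint t

namespace IsCenteredBody

variable {K : Set (Euc 2)}

lemma gauge_pos_iff (hK : IsCenteredBody K) {x : Euc 2} : 0 < gauge K x ↔ x ≠ 0 :=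
  gauge_pos (absorbent_nhds_zero hK.mem_nhds)
    (NormedSpace.isVonNBounded_of_isBounded ℝ hK.isCompact.isBounded)

lemma gauge_circlePoint_pos (hK : IsCenteredBody K) (t : ℝ) : 0 < gauge K (circlePoint t) :=
  hK.gauge_pos_iff.2 fun h => by simpa [h] using norm_circlePoint t

lemma gauge_boundaryCurve (hK : IsCenteredBody K) (t : ℝ) : gauge K (boundaryCurve K t) = 1 := by
  have h := hK.gauge_circlePoint_pos t
  rw [boundaryCurve, gauge_smul_of_nonneg (inv_nonneg.2 h.le), smul_eq_mul, inv_mul_cancel₀ h.ne']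

lemma boundaryCurve_mem_frontier (hK : IsCenteredBody K) (t : ℝ) :
    boundaryCurve K t ∈ frontier K :=
  (gauge_eq_one_iff_mem_frontier hK.convex hK.mem_nhds).1 (hK.gauge_boundaryCurve t)

lemma boundaryCurve_mem (hK : IsCenteredBody K) (t : ℝ) : boundaryCurve K t ∈ K :=
  hK.isCompact.isClosed.frontier_subset (hK.boundaryCurve_mem_frontier t)

lemma continuous_boundaryCurve (hK : IsCenteredBody K) : Continuous (boundaryCurve K) :=
  (((continuous_gauge hK.convex hK.mem_nhds).comp continuous_circlePoint).inv₀
    fun t => (hK.gauge_circlePoint_pos t).ne').smul continuous_circlePoint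

lemma boundaryCurve_sub_pi (hK : IsCenteredBody K) (t : ℝ) :
    boundaryCurve K (t - Real.pi) = -boundaryCurve K t := by
  rw [boundaryCurve, circlePoint_sub_pi, gauge_neg hK.neg_mem, smul_neg, boundaryCurve]

lemma circlePoint_eq (hK : IsCenteredBody K) (t : ℝ) :
    circlePoint t = gauge K (circlePoint t) • boundaryCurve K t := by
  rw [boundaryCurve, smul_inv_smul₀ (hK.gauge_circlePoint_pos t).ne']

lemma exists_eq_gauge_smul (hK : IsCenteredBody K) (x : Euc 2) :
    ∃ t ∈ Icc 0 Real.pi, x = gauge K x • boundaryCurve K t ∨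
      x = -(gauge K x • boundaryCurve K t) := by
  obtain ⟨t, ht, h⟩ := exists_eq_smul_circlePoint x
  have hg : gauge K (‖x‖ • circlePoint t) = gauge K x := by
    rcases h with h | h
    · rw [← h]
    · rw [← gauge_neg hK.neg_mem, ← h]
  have hx : ‖x‖ • circlePoint t = gauge K x • boundaryCurve K t := by
    rw [← hg, gauge_smul_of_nonneg (norm_nonneg x), smul_eq_mul, mul_smul, ← hK.circlePoint_eq t]
  exact ⟨t, ht, hx ▸ h⟩

lemma exists_abs_inner_boundaryCurve_eq (hK : IsCenteredBody K) (θ : Euc 2) :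
    ∃ t ∈ Icc 0 Real.pi, |⟪θ, boundaryCurve K t⟫| = suppFn K θ := by
  obtain ⟨y, hy, he⟩ := hK.exists_inner_eq_suppFn θ
  obtain ⟨t, ht, h⟩ := hK.exists_eq_gauge_smul y
  refine ⟨t, ht, le_antisymm (hK.abs_inner_le_suppFn θ (hK.boundaryCurve_mem t)) ?_⟩
  have h1 : |⟪θ, y⟫| = gauge K y * |⟪θ, boundaryCurve K t⟫| := by
    have : |⟪θ, gauge K y • boundaryCurve K t⟫| = gauge K y * |⟪θ, boundaryCurve K t⟫| := by
      rw [real_inner_smul_right, abs_mul, abs_of_nonneg (gauge_nonneg y)]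
    rcases h with h | h
    · rw [← this, ← h]
    · rw [← this, ← neg_eq_iff_eq_neg.2 h, inner_neg_right, abs_neg]
  rw [← he]
  refine (le_abs_self _).trans (h1.le.trans ?_)
  exact mul_le_of_le_one_left (abs_nonneg _) (gauge_le_one_of_mem hy)

lemma exists_cone_combination (hK : IsCenteredBody K) {s t r : ℝ} (hst : s ≤ t) (htr : t ≤ r)
    (hrs : r - s < Real.pi) :
    ∃ a b : ℝ, 0 ≤ a ∧ 0 ≤ b ∧ 1 ≤ a + b ∧
      boundaryCurve K t = a • boundaryCurve K s + b • boundaryCurve K r := by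
  suffices h : ∃ a b : ℝ, 0 ≤ a ∧ 0 ≤ b ∧
      boundaryCurve K t = a • boundaryCurve K s + b • boundaryCurve K r by
    obtain ⟨a, b, ha, hb, he⟩ := h
    refine ⟨a, b, ha, hb, ?_, he⟩
    have h1 := gauge_add_le hK.convex (absorbent_nhds_zero hK.mem_nhds)
      (a • boundaryCurve K s) (b • boundaryCurve K r)
    rwa [← he, gauge_smul_of_nonneg ha, gauge_smul_of_nonneg hb, hK.gauge_boundaryCurve,
      hK.gauge_boundaryCurve, hK.gauge_boundaryCurve, smul_eq_mul, smul_eq_mul, mul_one,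
      mul_one] at h1
  rcases eq_or_lt_of_le (hst.trans htr) with rfl | hsr
  · obtain rfl := le_antisymm hst htr
    exact ⟨1, 0, zero_le_one, le_rfl, by simp⟩
  have hsin : 0 < Real.sin (r - s) := Real.sin_pos_of_pos_of_lt_pi (by linarith) hrs
  have h1 : 0 ≤ Real.sin (r - t) := Real.sin_nonneg_of_nonneg_of_le_pi (by linarith) (by linarith)
  have h2 : 0 ≤ Real.sin (t - s) := Real.sin_nonneg_of_nonneg_of_le_pi (by linarith) (by linarith)
  have hu : Real.sin (r - s) • circlePoint t =
      Real.sin (r - t) • circlePoint s + Real.sin (t - s) • circlePoint r := by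
    ext i; fin_cases i <;> simp [Real.sin_sub]
    all_goals ring
  have gs := hK.gauge_circlePoint_pos s
  have gt := hK.gauge_circlePoint_pos t
  have gr := hK.gauge_circlePoint_pos r
  set c := (gauge K (circlePoint t))⁻¹ * (Real.sin (r - s))⁻¹ with hc
  have hc0 : 0 ≤ c := by positivity
  refine ⟨c * (Real.sin (r - t) * gauge K (circlePoint s)),
    c * (Real.sin (t - s) * gauge K (circlePoint r)), by positivity, by positivity, ?_⟩
  rw [mul_smul c, mul_smul c, mul_smul (Real.sin (r - t)), mul_smul (Real.sin (t - s)),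
    ← hK.circlePoint_eq, ← hK.circlePoint_eq, ← smul_add, ← hu, hc, mul_smul,
    inv_smul_smul₀ hsin.ne', boundaryCurve]

/-- Going around the boundary, a linear functional increases up to its maximum. -/
lemma monotoneOn_inner_boundaryCurve (hK : IsCenteredBody K) {θ : Euc 2} {m : ℝ}
    (hm : ⟪θ, boundaryCurve K m⟫ = suppFn K θ) :
    MonotoneOn (fun t => ⟪θ, boundaryCurve K t⟫) (Icc (m - Real.pi) m) := by
  have hle : ∀ t, ⟪θ, boundaryCurve K t⟫ ≤ suppFn K θ := fun t =>
    hK.inner_le_suppFn θ (hK.boundaryCurve_mem t)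
  have hopp : ⟪θ, boundaryCurve K (m - Real.pi)⟫ = -suppFn K θ := by
    rw [hK.boundaryCurve_sub_pi, inner_neg_right, hm]
  have hge : ∀ t, -suppFn K θ ≤ ⟪θ, boundaryCurve K t⟫ := fun t =>
    (abs_le.1 (hK.abs_inner_le_suppFn θ (hK.boundaryCurve_mem t))).1
  intro s hs t ht hst
  dsimp only
  rcases eq_or_lt_of_le ht.2 with rfl | htm
  · rw [hm]; exact hle s
  rcases eq_or_lt_of_le hs.1 with rfl | hsm
  · rw [hopp]; exact hge t
  rcases le_total 0 ⟪θ, boundaryCurve K s⟫ with h0 | h0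
  · obtain ⟨a, b, ha, hb, hab, he⟩ := hK.exists_cone_combination hst ht.2 (by linarith)
    rw [he, inner_add_right, real_inner_smul_right, real_inner_smul_right, hm]
    nlinarith [mul_le_mul_of_nonneg_left (hle s) hb]
  · rcases le_total 0 ⟪θ, boundaryCurve K t⟫ with h1 | h1
    · exact h0.trans h1
    · obtain ⟨a, b, ha, hb, hab, he⟩ := hK.exists_cone_combination hs.1 hst (by linarith)
      rw [he, inner_add_right, real_inner_smul_right, real_inner_smul_right, hopp]
      nlinarith [mul_le_mul_of_nonneg_left (hge t) ha]

lemma eVariationOn_inner_boundaryCurve_le_of_eq (hK : IsCenteredBody K) {θ : Euc 2} {m : ℝ}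
    (hmem : m ∈ Icc 0 Real.pi) (hm : ⟪θ, boundaryCurve K m⟫ = suppFn K θ) :
    eVariationOn (fun t => ⟪θ, boundaryCurve K t⟫) (Icc 0 Real.pi) ≤
      ENNReal.ofReal (2 * suppFn K θ) := by
  have hneg : ∀ t, ⟪θ, boundaryCurve K (t - Real.pi)⟫ = -⟪θ, boundaryCurve K t⟫ := fun t => by
    rw [hK.boundaryCurve_sub_pi, inner_neg_right]
  have hmono := hK.monotoneOn_inner_boundaryCurve hm
  have hle : ∀ t, ⟪θ, boundaryCurve K t⟫ ≤ suppFn K θ := fun t =>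
    hK.inner_le_suppFn θ (hK.boundaryCurve_mem t)
  have hmono' : MonotoneOn (fun t => -⟪θ, boundaryCurve K t⟫) (Icc m Real.pi) := by
    intro s hs t ht hst
    simp only [← hneg]
    exact hmono ⟨by linarith [hs.1], by linarith [hs.2, hmem.1]⟩
      ⟨by linarith [ht.1], by linarith [ht.2, hmem.1]⟩ (by linarith)
  have h1 := (hmono.mono (Icc_subset_Icc_left (by linarith [hmem.2]) : Icc 0 m ⊆ _)).eVariationOn_eq
    (left_mem_Icc.2 hmem.1) (right_mem_Icc.2 hmem.1)
  have h2 := hmono'.eVariationOn_eq (left_mem_Icc.2 hmem.2) (right_mem_Icc.2 hmem.2)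
  have h3 := eVariationOn.Icc_add_Icc (fun t => ⟪θ, boundaryCurve K t⟫) (s := univ)
    hmem.1 hmem.2 (mem_univ _)
  have h4 : eVariationOn (fun t => -⟪θ, boundaryCurve K t⟫) (Icc m Real.pi) =
      eVariationOn (fun t => ⟪θ, boundaryCurve K t⟫) (Icc m Real.pi) := by
    simp only [eVariationOn, edist_neg_neg]
  simp only [inter_self, univ_inter] at h1 h2 h3
  have h5 := hneg Real.pi
  rw [sub_self] at h5
  rw [← h3, ← h4, h1, h2, ← ENNReal.ofReal_add (by linarith [hle 0]) (by linarith [hle Real.pi])]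
  exact ENNReal.ofReal_le_ofReal (by linarith)

lemma suppFn_neg (hK : IsCenteredBody K) (θ : Euc 2) : suppFn K (-θ) = suppFn K θ := by
  have key : ∀ η, suppFn K (-η) ≤ suppFn K η := fun η => hK.suppFn_le fun y hy => by
    rw [inner_neg_left, ← inner_neg_right]
    exact hK.inner_le_suppFn η (hK.neg_mem y hy)
  exact (key θ).antisymm (by simpa using key (-θ))

lemma eVariationOn_inner_boundaryCurve_le (hK : IsCenteredBody K) (θ : Euc 2) :
    eVariationOn (fun t => ⟪θ, boundaryCurve K t⟫) (Icc 0 Real.pi) ≤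
      ENNReal.ofReal (2 * suppFn K θ) := by
  obtain ⟨m, hmem, hm⟩ := hK.exists_abs_inner_boundaryCurve_eq θ
  rcases abs_choice ⟪θ, boundaryCurve K m⟫ with h | h
  · exact hK.eVariationOn_inner_boundaryCurve_le_of_eq hmem (h ▸ hm)
  · have := hK.eVariationOn_inner_boundaryCurve_le_of_eq (θ := -θ) hmem
      (by rw [inner_neg_left, hK.suppFn_neg, ← h, hm])
    simp only [inner_neg_left, hK.suppFn_neg] at this
    simpa only [eVariationOn, edist_neg_neg] using this

lemma edist_inner_boundaryCurve (θ : Euc 2) (s t : ℝ) :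
    edist ⟪θ, boundaryCurve K s⟫ ⟪θ, boundaryCurve K t⟫ =
      ‖⟪boundaryCurve K s - boundaryCurve K t, θ⟫‖ₑ := by
  rw [edist_eq_enorm_sub, ← inner_sub_right, real_inner_comm]

lemma lintegral_sum_edist_inner (u : ℕ → ℝ) (n : ℕ) :
    ∫⁻ θ, ∑ i ∈ Finset.range n,
        edist ⟪θ, boundaryCurve K (u (i + 1))⟫ ⟪θ, boundaryCurve K (u i)⟫ ∂circleMeasure =
      cauchyConstant * ∑ i ∈ Finset.range n,
        edist (boundaryCurve K (u (i + 1))) (boundaryCurve K (u i)) := by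
  simp_rw [edist_inner_boundaryCurve]
  rw [lintegral_finsetSum _ fun i _ => measurable_enorm_inner _, Finset.mul_sum]
  refine Finset.sum_congr rfl fun i _ => ?_
  rw [lintegral_enorm_inner, edist_eq_enorm_sub]

lemma cauchyConstant_mul_eVariationOn_le (hK : IsCenteredBody K) :
    cauchyConstant * eVariationOn (boundaryCurve K) (Icc 0 Real.pi) ≤
      ∫⁻ θ, ENNReal.ofReal (2 * suppFn K θ) ∂circleMeasure := by
  rw [eVariationOn, ENNReal.mul_iSup]
  refine iSup_le fun p => ?_
  rw [← lintegral_sum_edist_inner]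
  refine lintegral_mono fun θ => ?_
  exact (eVariationOn.sum_le p.2.2.1 p.2.2.2).trans (hK.eVariationOn_inner_boundaryCurve_le θ)

lemma cauchyConstant_mul_frontier_le (hK : IsCenteredBody K) :
    cauchyConstant * μH[1] (frontier K) ≤
      2 * ∫⁻ θ, ENNReal.ofReal (2 * suppFn K θ) ∂circleMeasure := by
  set A := boundaryCurve K '' Icc 0 Real.pi with hA
  have hsub : frontier K ⊆ A ∪ (LinearIsometryEquiv.neg ℝ (E := Euc 2)) '' A := by
    intro x hx
    obtain ⟨t, ht, h⟩ := hK.exists_eq_gauge_smul x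
    rw [(gauge_eq_one_iff_mem_frontier hK.convex hK.mem_nhds).2 hx, one_smul] at h
    rcases h with h | h
    · exact .inl ⟨t, ht, h.symm⟩
    · exact .inr ⟨_, ⟨t, ht, rfl⟩, by simp [← h]⟩
  have h1 := (measure_mono hsub).trans (measure_union_le (μ := μH[1]) _ _)
  rw [(LinearIsometryEquiv.neg ℝ (E := Euc 2)).isometry.hausdorffMeasure_image
    (.inl zero_le_one), ← two_mul] at h1
  calc cauchyConstant * μH[1] (frontier K)
      ≤ cauchyConstant * (2 * eVariationOn (boundaryCurve K) (Icc 0 Real.pi)) := by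
        gcongr
        refine h1.trans ?_
        gcongr
        exact hausdorffMeasure_image_Icc_le_eVariationOn _ Real.pi_pos.le
    _ = 2 * (cauchyConstant * eVariationOn (boundaryCurve K) (Icc 0 Real.pi)) := by ring
    _ ≤ _ := by gcongr; exact hK.cauchyConstant_mul_eVariationOn_le

/-! ### The reverse estimate for the perimeter -/

lemma boundaryCurve_one_coord_nonneg (hK : IsCenteredBody K) {t : ℝ} (ht : t ∈ Ico 0 Real.pi) :
    0 ≤ boundaryCurve K t 1 := by
  have := Real.sin_nonneg_of_nonneg_of_le_pi ht.1 ht.2.le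
  have := hK.gauge_circlePoint_pos t
  simp only [boundaryCurve, PiLp.smul_apply, circlePoint_one_coord, smul_eq_mul]
  positivity

lemma boundaryCurve_eq_zero_of_one_coord (hK : IsCenteredBody K) {t : ℝ}
    (ht : t ∈ Ico 0 Real.pi) (h : boundaryCurve K t 1 = 0) : t = 0 := by
  have hg := hK.gauge_circlePoint_pos t
  simp only [boundaryCurve, PiLp.smul_apply, circlePoint_one_coord, smul_eq_mul] at h
  by_contra h0
  exact (mul_pos (inv_pos.2 hg)
    (Real.sin_pos_of_pos_of_lt_pi (lt_of_le_of_ne ht.1 (Ne.symm h0)) ht.2)).ne' h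

lemma boundaryCurve_ne_zero (hK : IsCenteredBody K) (t : ℝ) : boundaryCurve K t ≠ 0 :=
  hK.gauge_pos_iff.1 (by rw [hK.gauge_boundaryCurve]; exact one_pos)

lemma injOn_boundaryCurve (hK : IsCenteredBody K) : InjOn (boundaryCurve K) (Ico 0 Real.pi) := by
  intro s hs t ht h
  have hs0 := hK.gauge_circlePoint_pos s
  have ht0 := hK.gauge_circlePoint_pos t
  have hn := congrArg norm h
  simp only [boundaryCurve, norm_smul, norm_circlePoint, norm_inv, Real.norm_eq_abs,
    abs_of_pos hs0, abs_of_pos ht0, mul_one] at hn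
  rw [boundaryCurve, boundaryCurve, hn] at h
  have h0 := congrArg (fun x : Euc 2 => x 0) (smul_right_injective _ (inv_pos.2 ht0).ne' h)
  simp only [circlePoint_zero_coord] at h0
  exact Real.injOn_cos (Ico_subset_Icc_self hs) (Ico_subset_Icc_self ht) h0

lemma two_mul_hausdorffMeasure_le_frontier (hK : IsCenteredBody K) :
    2 * μH[1] (boundaryCurve K '' Ico 0 Real.pi) ≤ μH[1] (frontier K) := by
  set A := boundaryCurve K '' Ico 0 Real.pi with hA
  have hmeas : MeasurableSet A :=
    measurableSet_Ico.image_of_continuousOn_injOn hK.continuous_boundaryCurve.continuousOn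
      hK.injOn_boundaryCurve
  set σ := LinearIsometryEquiv.neg ℝ (E := Euc 2)
  have hdisj : Disjoint (σ '' A) A := by
    refine disjoint_left.2 ?_
    rintro _ ⟨_, ⟨s, hs, rfl⟩, rfl⟩ ⟨t, ht, he⟩
    change boundaryCurve K t = -boundaryCurve K s at he
    have h1 := congrArg (fun x : Euc 2 => x 1) he
    simp only [PiLp.neg_apply] at h1
    have hs1 := hK.boundaryCurve_one_coord_nonneg hs
    have ht1 := hK.boundaryCurve_one_coord_nonneg ht
    have hs0 := hK.boundaryCurve_eq_zero_of_one_coord hs (by linarith)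
    have ht0 := hK.boundaryCurve_eq_zero_of_one_coord ht (by linarith)
    rw [hs0, ht0] at he
    rw [eq_neg_iff_add_eq_zero, ← two_smul ℝ] at he
    exact hK.boundaryCurve_ne_zero 0 ((smul_eq_zero_iff_right two_ne_zero).1 he)
  have hsub : σ '' A ∪ A ⊆ frontier K := by
    rintro _ (⟨_, ⟨s, hs, rfl⟩, rfl⟩ | ⟨s, hs, rfl⟩)
    · change -boundaryCurve K s ∈ frontier K
      rw [← hK.boundaryCurve_sub_pi]
      exact hK.boundaryCurve_mem_frontier _
    · exact hK.boundaryCurve_mem_frontier s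
  have h := measure_mono (μ := μH[1]) hsub
  rwa [measure_union hdisj hmeas, σ.isometry.hausdorffMeasure_image (.inl zero_le_one),
    ← two_mul] at h

/-- Along a partition of mesh fine enough for the modulus of continuity `ε`, the variation of a
linear functional over half of the boundary nearly reaches the width. -/
lemma ofReal_two_mul_suppFn_le_sum (hK : IsCenteredBody K) {ε δ : ℝ}
    (hδ : ∀ s ∈ Icc 0 Real.pi, ∀ t ∈ Icc 0 Real.pi, |s - t| < δ →
      dist (boundaryCurve K s) (boundaryCurve K t) < ε) {N : ℕ} (hN : 0 < N)
    (hNδ : Real.pi / N < δ) {θ : Euc 2} (hθ : ‖θ‖ = 1) :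
    ENNReal.ofReal (2 * suppFn K θ) ≤
      ∑ i ∈ Finset.range N, edist ⟪θ, boundaryCurve K (((i + 1 : ℕ) : ℝ) * (Real.pi / N))⟫
        ⟪θ, boundaryCurve K ((i : ℝ) * (Real.pi / N))⟫ + ENNReal.ofReal (2 * ε) := by
  obtain ⟨m, hm, he⟩ := hK.exists_abs_inner_boundaryCurve_eq θ
  have hN' : (0 : ℝ) < N := Nat.cast_pos.2 hN
  set d := Real.pi / N with hd
  have hd0 : 0 < d := div_pos Real.pi_pos hN'
  have hNd : N * d = Real.pi := by rw [hd]; field_simp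
  set i := ⌊m / d⌋₊
  have hi1 : i * d ≤ m := (le_div_iff₀ hd0).1 (Nat.floor_le (div_nonneg hm.1 hd0.le))
  have hi2 : m < (i + 1) * d := (div_lt_iff₀ hd0).1 (Nat.lt_floor_add_one _)
  have hiN : i ≤ N := by
    have : (i : ℝ) ≤ N := le_of_mul_le_mul_right (by rw [hNd]; exact hi1.trans hm.2) hd0
    exact_mod_cast this
  set f : ℕ → ℝ := fun j => ⟪θ, boundaryCurve K ((j : ℝ) * d)⟫ with hf
  have hclose : suppFn K θ - ε ≤ |f i| := by
    have h1 := hδ m hm (i * d) ⟨by positivity, hi1.trans hm.2⟩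
      (by rw [abs_of_nonneg (by linarith)]; linarith)
    have h2 := abs_real_inner_le_norm θ (boundaryCurve K m - boundaryCurve K (i * d))
    rw [hθ, one_mul, ← dist_eq_norm, inner_sub_right] at h2
    have h3 := abs_sub_abs_le_abs_sub ⟪θ, boundaryCurve K m⟫ (f i)
    rw [he] at h3
    linarith
  have hends : f N = -f 0 := by
    have := hK.boundaryCurve_sub_pi Real.pi
    rw [sub_self] at this
    simp only [hf, hNd, Nat.cast_zero, zero_mul, this, inner_neg_right, neg_neg]
  have hsum : 2 * |f i| ≤ dist (f 0) (f i) + dist (f i) (f N) := by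
    rw [Real.dist_eq, Real.dist_eq, hends, abs_sub_comm (f 0), sub_neg_eq_add, ← abs_two,
      ← abs_mul]
    exact (by ring_nf : 2 * f i = (f i - f 0) + (f i + f 0)) ▸ abs_add_le _ _
  have hvar : ENNReal.ofReal (dist (f 0) (f i) + dist (f i) (f N)) ≤
      ∑ j ∈ Finset.range N, edist (f (j + 1)) (f j) := by
    rw [ENNReal.ofReal_add dist_nonneg dist_nonneg, ← edist_dist, ← edist_dist]
    simp_rw [edist_comm (f (_ + 1))]
    rw [Finset.range_eq_Ico, ← Finset.sum_Ico_consecutive _ i.zero_le hiN]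
    exact add_le_add (edist_le_Ico_sum_edist f i.zero_le) (edist_le_Ico_sum_edist f hiN)
  have hε : 0 ≤ ε := dist_nonneg.trans (hδ m hm m hm (by simpa using hd0.trans hNδ)).le
  calc ENNReal.ofReal (2 * suppFn K θ)
      ≤ ENNReal.ofReal (dist (f 0) (f i) + dist (f i) (f N) + 2 * ε) :=
        ENNReal.ofReal_le_ofReal (by linarith)
    _ = ENNReal.ofReal (dist (f 0) (f i) + dist (f i) (f N)) + ENNReal.ofReal (2 * ε) :=
        ENNReal.ofReal_add (by positivity) (by positivity)
    _ ≤ _ := by gcongr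

lemma lintegral_le_cauchyConstant_mul (hK : IsCenteredBody K) :
    ∫⁻ θ, ENNReal.ofReal (2 * suppFn K θ) ∂circleMeasure ≤
      cauchyConstant * μH[1] (boundaryCurve K '' Ico 0 Real.pi) := by
  have huc : UniformContinuousOn (boundaryCurve K) (Icc 0 Real.pi) :=
    isCompact_Icc.uniformContinuousOn_of_continuous hK.continuous_boundaryCurve.continuousOn
  have key : ∀ ε > 0, ∫⁻ θ, ENNReal.ofReal (2 * suppFn K θ) ∂circleMeasure ≤
      cauchyConstant * μH[1] (boundaryCurve K '' Ico 0 Real.pi) +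
        ENNReal.ofReal (2 * ε) * circleMeasure univ := by
    intro ε hε
    obtain ⟨δ, hδ0, hδ⟩ := Metric.uniformContinuousOn_iff.1 huc ε hε
    obtain ⟨n, hn⟩ := exists_nat_gt (Real.pi / δ)
    have hn0 : (0 : ℝ) < n := (div_pos Real.pi_pos hδ0).trans hn
    have hnδ : Real.pi / n < δ := (div_lt_comm₀ hδ0 hn0).1 hn
    have hmono : Monotone fun i : ℕ => (i : ℝ) * (Real.pi / n) := fun i j hij => by
      dsimp only
      have := Real.pi_pos
      gcongr
    have hlast : (n : ℝ) * (Real.pi / n) = Real.pi := by field_simp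
    have hsum := sum_edist_le_hausdorffMeasure_image_Ico hK.continuous_boundaryCurve hmono n
      (by simpa [hlast] using hK.injOn_boundaryCurve)
    simp only [Nat.cast_zero, zero_mul, hlast] at hsum
    calc ∫⁻ θ, ENNReal.ofReal (2 * suppFn K θ) ∂circleMeasure
        ≤ ∫⁻ θ, (∑ i ∈ Finset.range n,
            edist ⟪θ, boundaryCurve K (((i + 1 : ℕ) : ℝ) * (Real.pi / n))⟫
              ⟪θ, boundaryCurve K ((i : ℝ) * (Real.pi / n))⟫ + ENNReal.ofReal (2 * ε))
            ∂circleMeasure := by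
          refine lintegral_mono_ae ?_
          filter_upwards [ae_circleMeasure_norm] with θ hθ
          exact hK.ofReal_two_mul_suppFn_le_sum hδ (Nat.cast_pos.1 hn0) hnδ hθ
      _ = cauchyConstant * ∑ i ∈ Finset.range n,
            edist (boundaryCurve K (((i + 1 : ℕ) : ℝ) * (Real.pi / n)))
              (boundaryCurve K ((i : ℝ) * (Real.pi / n))) +
            ENNReal.ofReal (2 * ε) * circleMeasure univ := by
          rw [lintegral_add_right _ measurable_const, lintegral_const,
            lintegral_sum_edist_inner fun i : ℕ => (i : ℝ) * (Real.pi / n)]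
      _ ≤ _ := by
          gcongr
          simpa only [edist_comm] using hsum
  have hlim : Filter.Tendsto (fun ε : ℝ =>
      cauchyConstant * μH[1] (boundaryCurve K '' Ico 0 Real.pi) +
        ENNReal.ofReal (2 * ε) * circleMeasure univ) (nhdsWithin 0 (Ioi 0))
      (nhds (cauchyConstant * μH[1] (boundaryCurve K '' Ico 0 Real.pi) +
        ENNReal.ofReal (2 * 0) * circleMeasure univ)) := by
    refine tendsto_const_nhds.add (ENNReal.Tendsto.mul_const ?_ (.inr (measure_ne_top _ _)))
    have hcont : Continuous fun ε : ℝ => ENNReal.ofReal (2 * ε) :=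
      ENNReal.continuous_ofReal.comp (by fun_prop)
    exact hcont.continuousAt.mono_left nhdsWithin_le_nhds
  rw [mul_zero, ENNReal.ofReal_zero, zero_mul, add_zero] at hlim
  exact ge_of_tendsto hlim (by filter_upwards [self_mem_nhdsWithin] with ε hε using key ε hε)

lemma le_cauchyConstant_mul_frontier (hK : IsCenteredBody K) :
    2 * ∫⁻ θ, ENNReal.ofReal (2 * suppFn K θ) ∂circleMeasure ≤
      cauchyConstant * μH[1] (frontier K) :=
  calc 2 * ∫⁻ θ, ENNReal.ofReal (2 * suppFn K θ) ∂circleMeasure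
      ≤ 2 * (cauchyConstant * μH[1] (boundaryCurve K '' Ico 0 Real.pi)) := by
        gcongr
        exact hK.lintegral_le_cauchyConstant_mul
    _ = cauchyConstant * (2 * μH[1] (boundaryCurve K '' Ico 0 Real.pi)) := by ring
    _ ≤ _ := by gcongr; exact hK.two_mul_hausdorffMeasure_le_frontier

end IsCenteredBody

lemma IsConvexBody.isCenteredBody {K : Set (Euc 2)} (hK : IsConvexBody K) (hsym : K = -K)
    (h0 : (0 : Euc 2) ∈ interior K) : IsCenteredBody K where
  convex := hK.1
  isCompact := hK.2.1
  neg_mem x hx := by rwa [hsym, mem_neg, neg_neg]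
  mem_nhds := mem_interior_iff_mem_nhds.1 h0

/-- In `ℝ²`, if `Π_K(t) ≤ Π_L(t)` for all `t ≥ 0`, then the perimeter of
`K` is at most that of `L`, and `|K°| ≥ |L°|`. -/
theorem stmt_10 (K L : Set (Euc 2))
    (hK : IsConvexBody K) (hL : IsConvexBody L)
    (hKsym : K = -K) (hLsym : L = -L)
    (hK0 : (0 : Euc 2) ∈ interior K) (hL0 : (0 : Euc 2) ∈ interior L)
    (h : ∀ t : ℝ, 0 ≤ t → PiDist 2 K t ≤ PiDist 2 L t) :
    μH[(1 : ℝ)] (frontier K) ≤ μH[(1 : ℝ)] (frontier L) ∧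
    volume (polarBody L) ≤ volume (polarBody K) := by
  have hK' := hK.isCenteredBody hKsym hK0
  have hL' := hL.isCenteredBody hLsym hL0
  have hdist : ∀ s, 0 ≤ s → circleMeasure {θ | s ≤ suppFn K θ} ≤
      circleMeasure {θ | s ≤ suppFn L θ} := fun s hs => by
    have h1 := h (2 * s) (by positivity)
    rw [hK'.PiDist_two_mul, hL'.PiDist_two_mul] at h1
    have h2 := mul_le_mul_left h1 (circleMeasure univ)
    rwa [ENNReal.div_mul_cancel circleMeasure_univ_ne_zero (measure_ne_top _ _),
      ENNReal.div_mul_cancel circleMeasure_univ_ne_zero (measure_ne_top _ _)] at h2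
  have hint : ∫⁻ θ, ENNReal.ofReal (2 * suppFn K θ) ∂circleMeasure ≤
      ∫⁻ θ, ENNReal.ofReal (2 * suppFn L θ) ∂circleMeasure := by
    simp_rw [ENNReal.ofReal_mul zero_le_two]
    rw [lintegral_const_mul' _ _ ENNReal.ofReal_ne_top,
      lintegral_const_mul' _ _ ENNReal.ofReal_ne_top]
    exact mul_le_mul_right (lintegral_suppFn_le hK' hL' hdist) _
  refine ⟨?_, volume_polarBody_le hK' hL' hdist⟩
  rw [← ENNReal.mul_le_mul_iff_right cauchyConstant_ne_zero cauchyConstant_ne_top]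
  calc cauchyConstant * μH[1] (frontier K)
      ≤ 2 * ∫⁻ θ, ENNReal.ofReal (2 * suppFn K θ) ∂circleMeasure :=
        hK'.cauchyConstant_mul_frontier_le
    _ ≤ 2 * ∫⁻ θ, ENNReal.ofReal (2 * suppFn L θ) ∂circleMeasure := by gcongr
    _ ≤ cauchyConstant * μH[1] (frontier L) := hL'.le_cauchyConstant_mul_frontier
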